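/- arXiv:2302.11037 — 2 statements merged into one kernel-verified Lean document; each statement's English description precedes it below -/
import Mathlib

section
/- Let r > 0. For every x, y > 0 one has ∫_{|x−y|}^{x+y} c(r)·Δ(x,y,z)^{r−2}·(xyz)^{1−r}·z^r dz = 1; that is, dW_{x,y}(z) = c(r)·Δ(x,y,z)^{r−2}·(xyz)^{1−r} dμ(z) is a probability measure supported in the interval [|x−y|, x+y]. -/
open MeasureTheory Real Set

/-- Heron's formula: the area of a triangle with side lengths `x, y, z`. -/
noncomputable def triArea (x y z : ℝ) : ℝ :=
  (1 / 4) * Real.sqrt ((x + y + z) * (-x + y + z) * (x - y + z) * (x + y - z))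

/-- The normalizing constant `c(r) = 2^{r-2} Γ((r+1)/2) Γ(r/2)^{-1} π^{-1/2}`. -/
noncomputable def besselC (r : ℝ) : ℝ :=
  2 ^ (r - 2) * Real.Gamma ((r + 1) / 2) * (Real.Gamma (r / 2))⁻¹ * (Real.sqrt π)⁻¹

/-- The Euler beta integral over the reals. -/
lemma integral_Ioo_rpow_mul_one_sub_rpow {a b : ℝ} (ha : 0 < a) (hb : 0 < b) :
    ∫ t in Ioo (0 : ℝ) 1, t ^ (a - 1) * (1 - t) ^ (b - 1) =
      Real.Gamma a * Real.Gamma b / Real.Gamma (a + b) := by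
  rw [← ProbabilityTheory.beta, ProbabilityTheory.beta_eq_betaIntegralReal a b ha hb,
    Complex.betaIntegral, intervalIntegral.integral_of_le zero_le_one,
    ← integral_Ioc_eq_integral_Ioo]
  have h : ∀ t ∈ Ioc (0 : ℝ) 1,
      (t : ℂ) ^ ((a : ℂ) - 1) * (1 - (t : ℂ)) ^ ((b : ℂ) - 1) =
        ((t ^ (a - 1) * (1 - t) ^ (b - 1) : ℝ) : ℂ) := by
    intro t ht
    have h1 : 0 ≤ 1 - t := sub_nonneg.2 ht.2
    push_cast [Complex.ofReal_cpow ht.1.le, Complex.ofReal_cpow h1]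
    rfl
  rw [setIntegral_congr_fun measurableSet_Ioc h, integral_complex_ofReal, Complex.ofReal_re]

/-- The symmetric beta integral is the reciprocal of `2 * besselC r`. -/
lemma two_mul_besselC_mul_integral {r : ℝ} (hr : 0 < r) :
    2 * besselC r * ∫ t in Ioo (0 : ℝ) 1, t ^ (r / 2 - 1) * (1 - t) ^ (r / 2 - 1) = 1 := by
  have hr2 : 0 < r / 2 := half_pos hr
  rw [integral_Ioo_rpow_mul_one_sub_rpow hr2 hr2, add_halves, besselC]
  have hdup := Real.Gamma_mul_Gamma_add_half (r / 2)
  rw [show r / 2 + 1 / 2 = (r + 1) / 2 by ring, show 2 * (r / 2) = r by ring] at hdup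
  have hG := (Real.Gamma_pos_of_pos hr2).ne'
  have hG' := (Real.Gamma_pos_of_pos hr).ne'
  have hpi : √π ≠ 0 := (Real.sqrt_pos.2 pi_pos).ne'
  have h2 : (2 : ℝ) * 2 ^ (r - 2) * 2 ^ (1 - r) = 1 := by
    nth_rewrite 1 [← Real.rpow_one 2]
    rw [← Real.rpow_add two_pos, ← Real.rpow_add two_pos]
    ring_nf
    exact Real.rpow_zero 2
  calc 2 * (2 ^ (r - 2) * Real.Gamma ((r + 1) / 2) * (Real.Gamma (r / 2))⁻¹ * (√π)⁻¹) *
        (Real.Gamma (r / 2) * Real.Gamma (r / 2) / Real.Gamma r)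
      = 2 * 2 ^ (r - 2) * (Real.Gamma (r / 2) * Real.Gamma ((r + 1) / 2)) /
          (√π * Real.Gamma r) := by field_simp
    _ = 2 * 2 ^ (r - 2) * 2 ^ (1 - r) := by rw [hdup]; field_simp
    _ = 1 := h2

/-- The third side of a triangle with sides `x, y`, parametrized so that its square is affine. -/
noncomputable def thirdSide (x y t : ℝ) : ℝ :=
  √((x - y) ^ 2 + 4 * x * y * t)

lemma sq_thirdSide {x y t : ℝ} (hx : 0 < x) (hy : 0 < y) (ht : 0 < t) :
    thirdSide x y t ^ 2 = (x - y) ^ 2 + 4 * x * y * t :=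
  Real.sq_sqrt (by positivity)

lemma thirdSide_pos {x y t : ℝ} (hx : 0 < x) (hy : 0 < y) (ht : 0 < t) :
    0 < thirdSide x y t :=
  Real.sqrt_pos.2 (by positivity)

lemma hasDerivAt_thirdSide {x y t : ℝ} (hx : 0 < x) (hy : 0 < y) (ht : 0 < t) :
    HasDerivAt (thirdSide x y) (2 * x * y / thirdSide x y t) t := by
  have h : HasDerivAt (fun t : ℝ => (x - y) ^ 2 + 4 * x * y * t) (4 * x * y) t := by
    simpa using ((hasDerivAt_id t).const_mul (4 * x * y)).const_add ((x - y) ^ 2)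
  have hpos : 0 < (x - y) ^ 2 + 4 * x * y * t := by positivity
  refine (h.sqrt hpos.ne').congr_deriv ?_
  have := thirdSide_pos hx hy ht
  change 4 * x * y / (2 * thirdSide x y t) = _
  field_simp
  ring

lemma injOn_thirdSide {x y : ℝ} (hx : 0 < x) (hy : 0 < y) :
    InjOn (thirdSide x y) (Ioo 0 1) := by
  intro s hs t ht h
  have h2 := congrArg (· ^ 2) h
  simp only [sq_thirdSide hx hy hs.1, sq_thirdSide hx hy ht.1] at h2
  exact mul_left_cancel₀ (by positivity : 4 * x * y ≠ 0) (add_left_cancel h2)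

lemma image_thirdSide {x y : ℝ} (hx : 0 < x) (hy : 0 < y) :
    thirdSide x y '' Ioo 0 1 = Ioo |x - y| (x + y) := by
  have hxy : 0 < 4 * x * y := by positivity
  ext z
  constructor
  · rintro ⟨t, ht, rfl⟩
    have hsq := sq_thirdSide hx hy ht.1
    have hpos := thirdSide_pos hx hy ht.1
    refine ⟨abs_lt_of_sq_lt_sq ?_ hpos.le, lt_of_pow_lt_pow_left₀ 2 (by positivity) ?_⟩
    · nlinarith [mul_pos hxy ht.1]
    · nlinarith [mul_lt_mul_of_pos_left ht.2 hxy]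
  · rintro ⟨h1, h2⟩
    have hz : 0 < z := (abs_nonneg _).trans_lt h1
    have h3 : (x - y) ^ 2 < z ^ 2 := sq_lt_sq.2 (by rwa [abs_of_pos hz])
    have h4 : z ^ 2 < (x + y) ^ 2 := pow_lt_pow_left₀ h2 hz.le two_ne_zero
    refine ⟨(z ^ 2 - (x - y) ^ 2) / (4 * x * y),
      ⟨div_pos (sub_pos.2 h3) hxy, (div_lt_one hxy).2 (by linarith)⟩, ?_⟩
    rw [thirdSide, mul_div_cancel₀ _ hxy.ne', add_sub_cancel, Real.sqrt_sq hz.le]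

lemma triArea_thirdSide {x y t : ℝ} (hx : 0 < x) (hy : 0 < y) (ht : 0 < t) :
    triArea x y (thirdSide x y t) = x * y * √(t * (1 - t)) := by
  have h : (x + y + thirdSide x y t) * (-x + y + thirdSide x y t) * (x - y + thirdSide x y t) *
      (x + y - thirdSide x y t) = (4 * x * y) ^ 2 * (t * (1 - t)) := by
    calc _ = ((x + y) ^ 2 - thirdSide x y t ^ 2) * (thirdSide x y t ^ 2 - (x - y) ^ 2) := by ring
      _ = _ := by rw [sq_thirdSide hx hy ht]; ring
  rw [triArea, h, Real.sqrt_mul (sq_nonneg _), Real.sqrt_sq (by positivity)]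
  ring

lemma weight_thirdSide (r : ℝ) {x y t : ℝ} (hx : 0 < x) (hy : 0 < y) (ht : t ∈ Ioo (0 : ℝ) 1) :
    |2 * x * y / thirdSide x y t| • (besselC r * triArea x y (thirdSide x y t) ^ (r - 2) *
      (x * y * thirdSide x y t) ^ (1 - r) * thirdSide x y t ^ r) =
      2 * besselC r * (t ^ (r / 2 - 1) * (1 - t) ^ (r / 2 - 1)) := by
  have hz := thirdSide_pos hx hy ht.1
  have ht1 : 0 < 1 - t := sub_pos.2 ht.2
  have hxy : 0 < x * y := mul_pos hx hy
  rw [triArea_thirdSide hx hy ht.1]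
  generalize thirdSide x y t = z at hz ⊢
  have hsqrt : √(t * (1 - t)) ^ (r - 2) = t ^ (r / 2 - 1) * (1 - t) ^ (r / 2 - 1) := by
    rw [Real.sqrt_eq_rpow, ← Real.rpow_mul (mul_pos ht.1 ht1).le,
      ← Real.mul_rpow ht.1.le ht1.le]
    ring_nf
  have hpow : (x * y) * (x * y) ^ (r - 2) * (x * y) ^ (1 - r) = 1 := by
    nth_rewrite 1 [← Real.rpow_one (x * y)]
    rw [← Real.rpow_add hxy, ← Real.rpow_add hxy]
    ring_nf
    exact Real.rpow_zero _
  have hzpow : z ^ (1 - r) * z ^ r = z := by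
    rw [← Real.rpow_add hz, sub_add_cancel, Real.rpow_one]
  rw [abs_of_pos (by positivity), smul_eq_mul, Real.mul_rpow hxy.le (Real.sqrt_nonneg _),
    Real.mul_rpow hxy.le hz.le, hsqrt]
  generalize t ^ (r / 2 - 1) * (1 - t) ^ (r / 2 - 1) = w
  calc _ = 2 * besselC r * w * ((x * y) * (x * y) ^ (r - 2) * (x * y) ^ (1 - r)) *
        ((z ^ (1 - r) * z ^ r) / z) := by ring
    _ = 2 * besselC r * w := by rw [hpow, hzpow, div_self hz.ne', mul_one, mul_one]

/-- For `r > 0` and `x, y > 0`,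
`∫_{|x−y|}^{x+y} c(r) Δ(x,y,z)^{r−2} (xyz)^{1−r} z^r dz = 1`; that is,
`dW_{x,y}(z) = c(r) Δ(x,y,z)^{r−2} (xyz)^{1−r} dμ(z)` is a probability measure
supported in `[|x−y|, x+y]`. -/
theorem hankel_weight_integral_eq_one (r : ℝ) (hr : 0 < r) (x y : ℝ)
    (hx : 0 < x) (hy : 0 < y) :
    ∫ z in Set.Ioo |x - y| (x + y),
      besselC r * triArea x y z ^ (r - 2) * (x * y * z) ^ (1 - r) * z ^ r = 1 := by
  rw [← image_thirdSide hx hy, integral_image_eq_integral_abs_deriv_smul measurableSet_Ioo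
    (fun t ht => (hasDerivAt_thirdSide hx hy ht.1).hasDerivWithinAt) (injOn_thirdSide hx hy),
    setIntegral_congr_fun measurableSet_Ioo (fun t ht => weight_thirdSide r hx hy ht),
    integral_const_mul, two_mul_besselC_mul_integral hr]
end

section
/- Let r > 0, n = r + 1, let M ≥ 1 be an integer and let s₀ be a positive even integer. Let ψ ∈ C_c^∞(ℝ) be supported in {ξ : 1/4 ≤ |ξ| ≤ 4}, and let Φ : ℝ → ℝ be a Schwartz function with Φ(0) = 1 and Φ′(0) = 0. For α ∈ ℝ, ℓ ∈ ℤ, θ > 0 and ρ > 0, define F(x) = ψ(2^{−ℓ}x)·x^{2iα}·(1 − Φ(θρx))^M for x > 0, and let 𝓛 denote the differential operator (𝓛F)(x) = −F″(x) − (r/x)·F′(x). Then there exists a constant C > 0, depending only on r, s₀, M, ψ and Φ (but not on α, ℓ, θ, ρ), such that ‖(1 + 2^{2ℓ}𝓛)^{s₀/2} F‖_{L²((0,∞), x^r dx)} ≤ C·(1 + |α|)^{s₀}·2^{ℓn/2}·min(1, (2^ℓ·θ·ρ)^{2M}), where (1 + 2^{2ℓ}𝓛)^{s₀/2} denotes the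 (s₀/2)-fold composition of the map F ↦ F + 2^{2ℓ}·𝓛F. -/
open MeasureTheory Real Set ENNReal

/-- The measure `dμ(x) = x^r dx` on `(0, ∞)`. -/
noncomputable def besselMeasure (r : ℝ) : Measure ℝ :=
  (volume.restrict (Set.Ioi (0 : ℝ))).withDensity (fun x => ENNReal.ofReal (x ^ r))

/-- The Bessel differential operator `𝓛F(x) = −F″(x) − (r/x) F′(x)`. -/
noncomputable def besselOp (r : ℝ) (F : ℝ → ℂ) (x : ℝ) : ℂ :=
  -(deriv (deriv F) x) - (r / x : ℝ) * deriv F x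

/-- The frequency-localized multiplier
`F(x) = ψ(2^{−ℓ} x) x^{2iα} (1 − Φ(θρx))^M` for `x > 0` (and `0` otherwise),
where `x^{2iα} = exp(2iα log x)`. -/
noncomputable def multPiece (ψ : ℝ → ℝ) (Φ : ℝ → ℝ) (M : ℕ) (α : ℝ) (ℓ : ℤ)
    (θ ρ : ℝ) (x : ℝ) : ℂ :=
  if 0 < x then
    (ψ ((2 : ℝ) ^ (-ℓ) * x) : ℂ) *
      Complex.exp (2 * (α : ℂ) * Complex.I * (Real.log x : ℂ)) *
      (1 - (Φ (θ * ρ * x) : ℂ)) ^ M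
  else 0

/-- A family of smooth functions `g p` on `(1/8, 8)` whose derivatives of order `k ≤ N` are
bounded by a constant times `w p * A p ^ k`, uniformly in the parameter `p`. -/
def IsSymbol {P : Type*} (A w : P → ℝ) (N : ℕ) (g : P → ℝ → ℂ) : Prop :=
  (∀ p, ContDiffOn ℝ (⊤ : ℕ∞) (g p) (Ioo (1 / 8) 8)) ∧
    ∀ k ≤ N, ∃ C : ℝ, ∀ p, ∀ x ∈ Ioo (1 / 8 : ℝ) 8,
      ‖iteratedDerivWithin k (g p) (Ioo (1 / 8) 8) x‖ ≤ C * (w p * A p ^ k)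

lemma uniqueDiffOn_window : UniqueDiffOn ℝ (Ioo (1 / 8 : ℝ) 8) := isOpen_Ioo.uniqueDiffOn

namespace IsSymbol

variable {P : Type*} {A w v : P → ℝ} {N : ℕ} {f g : P → ℝ → ℂ}

lemma congr (hf : IsSymbol A w N f) (h : ∀ p, EqOn (g p) (f p) (Ioo (1 / 8) 8)) :
    IsSymbol A w N g := by
  refine ⟨fun p => (hf.1 p).congr (h p), fun k hk => ?_⟩
  obtain ⟨C, hC⟩ := hf.2 k hk
  exact ⟨C, fun p x hx => by rw [iteratedDerivWithin_congr (h p) hx]; exact hC p x hx⟩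

lemma mono_order {N' : ℕ} (hf : IsSymbol A w N f) (h : N' ≤ N) : IsSymbol A w N' f :=
  ⟨hf.1, fun k hk => hf.2 k (hk.trans h)⟩

lemma mono_weight (hA : ∀ p, 1 ≤ A p) (hw : ∀ p, 0 ≤ w p) (hf : IsSymbol A w N f)
    (h : ∀ p, w p ≤ v p) : IsSymbol A v N f := by
  refine ⟨hf.1, fun k hk => ?_⟩
  obtain ⟨C, hC⟩ := hf.2 k hk
  refine ⟨|C|, fun p x hx => (hC p x hx).trans ?_⟩
  have := hA p
  have := hw p
  exact mul_le_mul (le_abs_self C) (mul_le_mul_of_nonneg_right (h p) (by positivity))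
    (by positivity) (abs_nonneg C)

lemma add (hf : IsSymbol A w N f) (hg : IsSymbol A w N g) :
    IsSymbol A w N (fun p x => f p x + g p x) := by
  refine ⟨fun p => (hf.1 p).add (hg.1 p), fun k hk => ?_⟩
  obtain ⟨C, hC⟩ := hf.2 k hk
  obtain ⟨D, hD⟩ := hg.2 k hk
  refine ⟨C + D, fun p x hx => ?_⟩
  have hk' : ((k : ℕ) : WithTop ℕ∞) ≤ ((⊤ : ℕ∞) : WithTop ℕ∞) := by exact_mod_cast le_top
  rw [iteratedDerivWithin_fun_add hx uniqueDiffOn_window ((hf.1 p x hx).of_le hk')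
    ((hg.1 p x hx).of_le hk'), add_mul]
  exact (norm_add_le _ _).trans (add_le_add (hC p x hx) (hD p x hx))

lemma mul (hA : ∀ p, 1 ≤ A p) (hw : ∀ p, 0 ≤ w p) (hv : ∀ p, 0 ≤ v p)
    (hf : IsSymbol A w N f) (hg : IsSymbol A v N g) :
    IsSymbol A (fun p => w p * v p) N (fun p x => f p x * g p x) := by
  refine ⟨fun p => (hf.1 p).mul (hg.1 p), fun k hk => ?_⟩
  choose! C hC using hf.2
  choose! D hD using hg.2
  refine ⟨∑ i ∈ Finset.range (k + 1), (k.choose i : ℝ) * |C i| * |D (k - i)|, fun p x hx => ?_⟩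
  have hk' : ((k : ℕ) : WithTop ℕ∞) ≤ ((⊤ : ℕ∞) : WithTop ℕ∞) := by exact_mod_cast le_top
  have hA0 : 0 ≤ A p := zero_le_one.trans (hA p)
  have hw0 := hw p
  have hv0 := hv p
  rw [← norm_iteratedFDerivWithin_eq_norm_iteratedDerivWithin]
  refine (norm_iteratedFDerivWithin_mul_le (hf.1 p) (hg.1 p) uniqueDiffOn_window hx hk').trans ?_
  simp only [norm_iteratedFDerivWithin_eq_norm_iteratedDerivWithin]
  rw [Finset.sum_mul]
  refine Finset.sum_le_sum fun i hi => ?_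
  have hik : i ≤ k := Nat.lt_succ_iff.1 (Finset.mem_range.1 hi)
  have h1 : ‖iteratedDerivWithin i (f p) (Ioo (1 / 8) 8) x‖ ≤ |C i| * (w p * A p ^ i) :=
    (hC i (hik.trans hk) p x hx).trans
      (mul_le_mul_of_nonneg_right (le_abs_self _) (by positivity))
  have h2 : ‖iteratedDerivWithin (k - i) (g p) (Ioo (1 / 8) 8) x‖
      ≤ |D (k - i)| * (v p * A p ^ (k - i)) :=
    (hD (k - i) ((Nat.sub_le _ _).trans hk) p x hx).trans
      (mul_le_mul_of_nonneg_right (le_abs_self _) (by positivity))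
  calc _ ≤ (k.choose i : ℝ) * (|C i| * (w p * A p ^ i))
        * (|D (k - i)| * (v p * A p ^ (k - i))) := by gcongr
    _ = (k.choose i : ℝ) * |C i| * |D (k - i)| * (w p * v p * (A p ^ i * A p ^ (k - i))) := by
      ring
    _ = _ := by rw [← pow_add, Nat.add_sub_cancel' hik]

lemma derivWithin (hf : IsSymbol A w (N + 1) f) :
    IsSymbol A (fun p => w p * A p) N (fun p => derivWithin (f p) (Ioo (1 / 8) 8)) := by
  refine ⟨fun p => (hf.1 p).derivWithin uniqueDiffOn_window (by simp), fun k hk => ?_⟩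
  obtain ⟨C, hC⟩ := hf.2 (k + 1) (by omega)
  refine ⟨C, fun p x hx => ?_⟩
  rw [← iteratedDerivWithin_succ']
  exact (hC p x hx).trans_eq (by ring)

lemma deriv (hf : IsSymbol A w (N + 1) f) :
    IsSymbol A (fun p => w p * A p) N (fun p => deriv (f p)) :=
  hf.derivWithin.congr fun _ _ hx => (derivWithin_of_isOpen isOpen_Ioo hx).symm

lemma of_derivWithin (hf : ∀ p, ContDiffOn ℝ (⊤ : ℕ∞) (f p) (Ioo (1 / 8) 8))
    (h0 : IsSymbol A w 0 f)
    (h : IsSymbol A (fun p => w p * A p) N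
      (fun p => _root_.derivWithin (f p) (Ioo (1 / 8) 8))) :
    IsSymbol A w (N + 1) f := by
  refine ⟨hf, fun k hk => ?_⟩
  rcases k with _ | k
  · exact h0.2 0 le_rfl
  · obtain ⟨C, hC⟩ := h.2 k (by omega)
    refine ⟨C, fun p x hx => ?_⟩
    rw [iteratedDerivWithin_succ']
    exact (hC p x hx).trans_eq (by ring)

lemma const_of_contDiffOn (hA : ∀ p, 1 ≤ A p) {h : ℝ → ℂ}
    (hh : ContDiffOn ℝ (⊤ : ℕ∞) h (Ioi 0)) : IsSymbol A (fun _ => 1) N (fun _ => h) := by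
  have hsub : Ioo (1 / 8 : ℝ) 8 ⊆ Ioi 0 := fun x hx => lt_trans (by norm_num) hx.1
  refine ⟨fun _ => hh.mono hsub, fun k _ => ?_⟩
  have hc : ContinuousOn (iteratedDerivWithin k h (Ioi 0)) (Icc (1 / 8) 8) :=
    (hh.continuousOn_iteratedDerivWithin (by exact_mod_cast le_top)
      isOpen_Ioi.uniqueDiffOn).mono fun x hx => lt_of_lt_of_le (by norm_num) hx.1
  obtain ⟨C, hC⟩ := isCompact_Icc.exists_bound_of_continuousOn hc
  refine ⟨|C|, fun p x hx => ?_⟩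
  rw [iteratedDerivWithin_of_isOpen isOpen_Ioo hx,
    ← iteratedDerivWithin_of_isOpen isOpen_Ioi (hsub hx), one_mul]
  exact (hC x (Ioo_subset_Icc_self hx)).trans ((le_abs_self C).trans
    (le_mul_of_one_le_right (abs_nonneg C) (one_le_pow₀ (hA p))))

lemma const_param (hA : ∀ p, 1 ≤ A p) {c : P → ℂ} (hc : ∀ p, ‖c p‖ ≤ w p) :
    IsSymbol A w N (fun p _ => c p) := by
  refine ⟨fun _ => contDiffOn_const, fun k _ => ⟨1, fun p x hx => ?_⟩⟩
  have hA' := one_le_pow₀ (hA p) (n := k)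
  have hw : 0 ≤ w p := (norm_nonneg _).trans (hc p)
  rw [iteratedDerivWithin_const]
  split_ifs
  · rw [one_mul]
    exact (hc p).trans (le_mul_of_one_le_right hw hA')
  · rw [norm_zero]
    positivity

lemma pow (hA : ∀ p, 1 ≤ A p) (hw : ∀ p, 0 ≤ w p) (hf : IsSymbol A w N f) (M : ℕ) :
    IsSymbol A (fun p => w p ^ M) N (fun p x => f p x ^ M) := by
  induction M with
  | zero => simpa using const_param (N := N) (w := fun _ => 1) hA (c := fun _ => 1) (by simp)
  | succ M ih =>
    simp only [pow_succ]
    exact ih.mul hA (fun p => pow_nonneg (hw p) M) hw hf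

lemma besselStep (r : ℝ) (hA : ∀ p, 1 ≤ A p) (hw : ∀ p, 0 ≤ w p)
    (hf : ∀ N, IsSymbol A w N f) (N : ℕ) :
    IsSymbol A (fun p => w p * A p ^ 2) N (fun p x => f p x + 1 * besselOp r (f p) x) := by
  have hA0 : ∀ p, 0 ≤ A p := fun p => zero_le_one.trans (hA p)
  have hd : IsSymbol A (fun p => w p * A p) N (fun p => _root_.deriv (f p)) := (hf (N + 1)).deriv
  have hdd : IsSymbol A (fun p => w p * A p ^ 2) N
      (fun p => _root_.deriv (_root_.deriv (f p))) := by
    simpa only [pow_two, mul_assoc] using (hf (N + 2)).deriv.deriv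
  have hr : ContDiffOn ℝ (⊤ : ℕ∞) (fun x : ℝ => -((r / x : ℝ) : ℂ)) (Ioi 0) :=
    (Complex.ofRealCLM.contDiff.comp_contDiffOn
      (contDiffOn_const.div contDiffOn_id fun x hx => (ne_of_gt hx))).neg
  have h1 := (const_of_contDiffOn (N := N) hA hr).mul hA (fun _ => zero_le_one)
    (fun p => mul_nonneg (hw p) (hA0 p)) hd
  have h2 := (const_param (N := N) (w := fun _ => 1) hA (c := fun _ => (-1 : ℂ)) (by simp)).mul
    hA (fun _ => zero_le_one) (fun p => mul_nonneg (hw p) (pow_nonneg (hA0 p) 2)) hdd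
  have h0 : IsSymbol A (fun p => w p * A p ^ 2) N f := (hf N).mono_weight hA hw fun p =>
    le_mul_of_one_le_right (hw p) (one_le_pow₀ (hA p))
  have h1' : IsSymbol A (fun p => w p * A p ^ 2) N
      (fun p x => -((r / x : ℝ) : ℂ) * _root_.deriv (f p) x) :=
    h1.mono_weight hA (fun p => mul_nonneg zero_le_one (mul_nonneg (hw p) (hA0 p))) fun p => by
      rw [one_mul]
      exact mul_le_mul_of_nonneg_left (le_self_pow₀ (hA p) two_ne_zero) (hw p)
  simp only [one_mul] at h2
  refine (h0.add (h2.add h1')).congr fun p x _ => ?_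
  simp only [besselOp]
  ring

lemma besselStep_iterate (r : ℝ) (hA : ∀ p, 1 ≤ A p) (hw : ∀ p, 0 ≤ w p)
    (hf : ∀ N, IsSymbol A w N f) (m : ℕ) : ∀ N, IsSymbol A (fun p => w p * A p ^ (2 * m)) N
      (fun p => (fun G : ℝ → ℂ => fun x : ℝ => G x + 1 * besselOp r G x)^[m] (f p)) := by
  induction m with
  | zero => simpa using hf
  | succ m ih =>
    intro N
    have h := besselStep r hA
      (fun p => mul_nonneg (hw p) (pow_nonneg (zero_le_one.trans (hA p)) (2 * m))) ih N
    simp only [Function.iterate_succ_apply']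
    simpa only [mul_assoc, ← pow_add, Nat.mul_succ] using h

/-- The oscillating power `x ^ (2 i α)` is a symbol with derivatives of size `(1 + |α|) ^ k`. -/
lemma oscillation (α : P → ℝ) (N : ℕ) : IsSymbol (fun p => 1 + |α p|) (fun _ => 1) N
    (fun p x => Complex.exp (2 * (α p : ℂ) * Complex.I * (Real.log x : ℂ))) := by
  have hA : ∀ p, 1 ≤ 1 + |α p| := fun p => le_add_of_nonneg_right (abs_nonneg _)
  have hpos : ∀ x ∈ Ioo (1 / 8 : ℝ) 8, x ≠ 0 := fun x hx => by
    have := hx.1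
    intro h
    norm_num [h] at this
  have hsmooth : ∀ p, ContDiffOn ℝ (⊤ : ℕ∞)
      (fun x : ℝ => Complex.exp (2 * (α p : ℂ) * Complex.I * (Real.log x : ℂ)))
      (Ioo (1 / 8) 8) := fun p =>
    (contDiffOn_const.mul (Complex.ofRealCLM.contDiff.comp_contDiffOn
      (contDiffOn_id.log hpos))).cexp
  have h0 : IsSymbol (fun p => 1 + |α p|) (fun _ => 1) 0
      (fun p x => Complex.exp (2 * (α p : ℂ) * Complex.I * (Real.log x : ℂ))) := by
    refine ⟨hsmooth, fun k hk => ⟨1, fun p x hx => ?_⟩⟩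
    obtain rfl : k = 0 := by omega
    have : 2 * (α p : ℂ) * Complex.I * (Real.log x : ℂ)
      = ((2 * α p * Real.log x : ℝ) : ℂ) * Complex.I := by push_cast; ring
    rw [iteratedDerivWithin_zero]
    beta_reduce
    rw [this, Complex.norm_exp_ofReal_mul_I]
    simp
  induction N with
  | zero => exact h0
  | succ N ih =>
    refine of_derivWithin hsmooth h0 ?_
    have hinv : ContDiffOn ℝ (⊤ : ℕ∞) (fun x : ℝ => 2 * Complex.I * ((x⁻¹ : ℝ) : ℂ)) (Ioi 0) :=
      contDiffOn_const.mul (Complex.ofRealCLM.contDiff.comp_contDiffOn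
        (contDiffOn_id.inv fun x hx => ne_of_gt hx))
    have hα : IsSymbol (fun p => 1 + |α p|) (fun p => 1 + |α p|) N (fun p _ => (α p : ℂ)) :=
      const_param hA fun p => by simp
    refine ((ih.mul hA (fun _ => zero_le_one) (fun _ => zero_le_one)
      (const_of_contDiffOn hA hinv)).mul hA (fun _ => by norm_num)
      (fun p => zero_le_one.trans (hA p)) hα).congr (fun p x hx => ?_) |>.mono_weight hA
        (fun p => by positivity) (fun p => by simp)
    rw [derivWithin_of_isOpen isOpen_Ioo hx]
    have h := ((((Real.hasDerivAt_log (hpos x hx)).ofReal_comp).const_mul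
      (2 * (α p : ℂ) * Complex.I)).cexp).deriv
    rw [h]
    ring

end IsSymbol

/-- A Schwartz function equal to `1` to second order at the origin satisfies scale-invariant
derivative bounds that vanish quadratically at the origin. -/
lemma SchwartzMap.exists_one_sub_bound (Φ : SchwartzMap ℝ ℝ) (hΦ0 : Φ 0 = 1)
    (hΦ1 : deriv (⇑Φ) 0 = 0) (k : ℕ) :
    ∃ C : ℝ, 0 ≤ C ∧ ∀ u : ℝ,
      |u| ^ k * |iteratedDeriv k (fun x => 1 - Φ x) u| ≤ C * min 1 (u ^ 2) := by
  have hdecay : ∀ i n : ℕ, ∃ C : ℝ, 0 < C ∧ ∀ u : ℝ, |u| ^ i * |iteratedDeriv n (⇑Φ) u| ≤ C := by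
    intro i n
    obtain ⟨C, hC0, hC⟩ := Φ.decay i n
    refine ⟨C, hC0, fun u => ?_⟩
    have := hC u
    rwa [norm_iteratedFDeriv_eq_norm_iteratedDeriv, Real.norm_eq_abs, Real.norm_eq_abs] at this
  have hderiv : ∀ n : ℕ, 0 < n → ∀ u : ℝ,
      |iteratedDeriv n (fun x => 1 - Φ x) u| = |iteratedDeriv n (⇑Φ) u| := by
    intro n hn u
    rw [iteratedDeriv_const_sub hn, iteratedDeriv_neg, abs_neg]
  obtain ⟨B, hB0, hB⟩ := hdecay 0 2
  have h1 : ∀ u : ℝ, |deriv (⇑Φ) u| ≤ B * |u| := by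
    intro u
    have hdiff : Differentiable ℝ (deriv (⇑Φ)) := by
      have := Φ.smooth'.differentiable_iteratedDeriv 1 (by exact_mod_cast WithTop.coe_lt_top _)
      rwa [iteratedDeriv_one] at this
    have := convex_univ.norm_image_sub_le_of_norm_deriv_le (𝕜 := ℝ) (f := deriv (⇑Φ)) (C := B)
      (fun x _ => hdiff x) (fun x _ => by
        have := hB x
        rw [iteratedDeriv_succ, iteratedDeriv_one, pow_zero, one_mul] at this
        exact this) (mem_univ 0) (mem_univ u)
    simpa [hΦ1] using this
  have h0 : ∀ u : ℝ, |1 - Φ u| ≤ B * u ^ 2 := by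
    intro u
    have := (convex_Icc (-|u|) |u|).norm_image_sub_le_of_norm_deriv_le (𝕜 := ℝ) (f := ⇑Φ)
      (C := B * |u|) (fun x _ => Φ.differentiableAt)
      (fun x hx => (h1 x).trans (mul_le_mul_of_nonneg_left (abs_le.2 hx) hB0.le))
      (x := 0) (y := u)
      (mem_Icc.2 ⟨neg_nonpos.2 (abs_nonneg u), abs_nonneg u⟩) ⟨neg_abs_le u, le_abs_self u⟩
    rw [hΦ0, sub_zero, Real.norm_eq_abs, Real.norm_eq_abs, abs_sub_comm, mul_assoc, ← pow_two,
      sq_abs] at this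
    exact this
  have key : ∀ {a b D E : ℝ}, 0 ≤ b → 0 ≤ D → 0 ≤ E → a ≤ D → a ≤ E * b →
      a ≤ (D + E) * min 1 b := by
    intro a b D E hb hD hE h h'
    rcases min_cases 1 b with ⟨h2, _⟩ | ⟨h2, _⟩ <;> rw [h2] <;> nlinarith
  rcases k with _ | _ | k
  · obtain ⟨D, hD0, hD⟩ := hdecay 0 0
    refine ⟨(1 + D) + B, by positivity, fun u => key (sq_nonneg u) (by positivity) hB0.le ?_ ?_⟩
    · have := hD u
      simp only [pow_zero, one_mul, iteratedDeriv_zero] at this ⊢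
      exact (abs_sub 1 (Φ u)).trans (by rw [abs_one]; linarith)
    · simpa using h0 u
  · obtain ⟨D, hD0, hD⟩ := hdecay 1 1
    refine ⟨D + B, by positivity, fun u => key (sq_nonneg u) hD0.le hB0.le ?_ ?_⟩
    · rw [hderiv _ (by omega)]
      exact hD u
    · rw [hderiv _ (by omega), zero_add, pow_one, iteratedDeriv_one, ← sq_abs]
      nlinarith [h1 u, abs_nonneg u]
  · obtain ⟨D, hD0, hD⟩ := hdecay (k + 2) (k + 2)
    obtain ⟨E, hE0, hE⟩ := hdecay k (k + 2)
    refine ⟨D + E, by positivity, fun u => key (sq_nonneg u) hD0.le hE0.le ?_ ?_⟩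
    · rw [hderiv _ (by omega)]
      exact hD u
    · rw [hderiv _ (by omega), ← sq_abs]
      calc _ = |u| ^ k * |iteratedDeriv (k + 2) (⇑Φ) u| * |u| ^ 2 := by ring
        _ ≤ E * |u| ^ 2 := mul_le_mul_of_nonneg_right (hE u) (sq_nonneg _)

namespace IsSymbol

lemma one_sub_dilation {P : Type*} {A : P → ℝ} (hA : ∀ p, 1 ≤ A p) (t : P → ℝ)
    (Φ : SchwartzMap ℝ ℝ) (hΦ0 : Φ 0 = 1) (hΦ1 : _root_.deriv (⇑Φ) 0 = 0) (N : ℕ) :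
    IsSymbol A (fun p => min 1 (t p ^ 2)) N (fun p x => 1 - (Φ (t p * x) : ℂ)) := by
  have hsm : ContDiff ℝ (⊤ : ℕ∞) (fun x => 1 - Φ x) := contDiff_const.sub Φ.smooth'
  have hst : ∀ p, ContDiff ℝ (⊤ : ℕ∞) (fun x => 1 - Φ (t p * x)) := fun p =>
    hsm.comp (contDiff_const.mul contDiff_id)
  have heq : ∀ p, (fun x => 1 - (Φ (t p * x) : ℂ))
      = Complex.ofRealLI ∘ (fun x => 1 - Φ (t p * x)) := fun p => by
    ext x
    simp
  refine ⟨fun p => ?_, fun k _ => ?_⟩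
  · beta_reduce
    rw [heq]
    exact (Complex.ofRealLI.contDiff.comp (hst p)).contDiffOn
  · obtain ⟨C, hC0, hC⟩ := Φ.exists_one_sub_bound hΦ0 hΦ1 k
    have hk : ((k : ℕ) : WithTop ℕ∞) ≤ ((⊤ : ℕ∞) : WithTop ℕ∞) := by exact_mod_cast le_top
    refine ⟨8 ^ k * (C * 64), fun p x hx => ?_⟩
    have hx0 : 0 < x := lt_trans (by norm_num) hx.1
    rw [iteratedDerivWithin_of_isOpen isOpen_Ioo hx]
    beta_reduce
    rw [heq,
      ← norm_iteratedFDeriv_eq_norm_iteratedDeriv,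
      Complex.ofRealLI.norm_iteratedFDeriv_comp_left (hst p).contDiffAt hk,
      norm_iteratedFDeriv_eq_norm_iteratedDeriv,
      iteratedDeriv_comp_const_mul (f := fun x => 1 - Φ x) (hsm.of_le hk) (t p),
      norm_mul, norm_pow, Real.norm_eq_abs, Real.norm_eq_abs]
    have h8 : |t p| ≤ 8 * |t p * x| := by
      rw [abs_mul, abs_of_pos hx0]
      nlinarith [abs_nonneg (t p), hx.1]
    have hmin : min 1 ((t p * x) ^ 2) ≤ 64 * min 1 (t p ^ 2) := by
      rw [mul_min_of_nonneg _ _ (by norm_num)]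
      refine min_le_min (by norm_num) ?_
      rw [mul_pow, mul_comm]
      refine mul_le_mul_of_nonneg_right ?_ (sq_nonneg _)
      nlinarith [hx.2]
    have hm0 : 0 ≤ min 1 (t p ^ 2) := le_min zero_le_one (sq_nonneg _)
    calc |t p| ^ k * |iteratedDeriv k (fun x => 1 - Φ x) (t p * x)|
        ≤ (8 * |t p * x|) ^ k * |iteratedDeriv k (fun x => 1 - Φ x) (t p * x)| := by gcongr
      _ = 8 ^ k * (|t p * x| ^ k * |iteratedDeriv k (fun x => 1 - Φ x) (t p * x)|) := by ring
      _ ≤ 8 ^ k * (C * (64 * min 1 (t p ^ 2))) := by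
        exact mul_le_mul_of_nonneg_left
          ((hC _).trans (mul_le_mul_of_nonneg_left hmin hC0)) (by positivity)
      _ = 8 ^ k * (C * 64) * (min 1 (t p ^ 2) * 1) := by ring
      _ ≤ _ := by
        gcongr
        exact one_le_pow₀ (hA p)

end IsSymbol

/-- Uniform bounds for the iterates of `1 + 𝓛` on the rescaled multiplier piece. -/
lemma exists_bound_besselStep_iterate_multPiece (r : ℝ) (M m : ℕ) (ψ : ℝ → ℝ)
    (hψ : ContDiff ℝ (⊤ : ℕ∞) ψ) (Φ : SchwartzMap ℝ ℝ) (hΦ0 : Φ 0 = 1)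
    (hΦ1 : deriv (⇑Φ) 0 = 0) :
    ∃ C : ℝ, 0 < C ∧ ∀ α t x : ℝ, x ∈ Ioo (1 / 8 : ℝ) 8 →
      ‖(fun G : ℝ → ℂ => fun x : ℝ => G x + 1 * besselOp r G x)^[m]
        (multPiece ψ (⇑Φ) M α 0 t 1) x‖ ≤ C * ((1 + |α|) ^ (2 * m) * min 1 (t ^ 2) ^ M) := by
  have hA : ∀ p : ℝ × ℝ, 1 ≤ 1 + |p.1| := fun p => le_add_of_nonneg_right (abs_nonneg _)
  have hw : ∀ p : ℝ × ℝ, 0 ≤ min 1 (p.2 ^ 2) := fun p => le_min zero_le_one (sq_nonneg _)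
  have hsymbol : ∀ N, IsSymbol (fun p : ℝ × ℝ => 1 + |p.1|) (fun p => min 1 (p.2 ^ 2) ^ M) N
      (fun p => multPiece ψ (⇑Φ) M p.1 0 p.2 1) := by
    intro N
    have h1 := IsSymbol.const_of_contDiffOn (N := N) hA
      (Complex.ofRealCLM.contDiff.comp hψ).contDiffOn
    have h2 := IsSymbol.oscillation (fun p : ℝ × ℝ => p.1) N
    have h3 := (IsSymbol.one_sub_dilation hA (fun p : ℝ × ℝ => p.2) Φ hΦ0 hΦ1 N).pow hA hw M
    have h := (h1.mul hA (fun _ => zero_le_one) (fun _ => zero_le_one) h2).mul hA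
      (fun _ => by norm_num) (fun p => pow_nonneg (hw p) M) h3
    simp only [one_mul] at h
    refine h.congr fun p x hx => ?_
    have hx0 : 0 < x := lt_trans (by norm_num) hx.1
    simp [multPiece, hx0]
  obtain ⟨C, hC⟩ := (IsSymbol.besselStep_iterate r hA (fun p => pow_nonneg (hw p) M) hsymbol m 0).2
    0 le_rfl
  refine ⟨|C| + 1, by positivity, fun α t x hx => ?_⟩
  have h := hC (α, t) x hx
  have hw' := hw (α, t)
  simp only [iteratedDerivWithin_zero, pow_zero, mul_one] at h hw'
  rw [mul_comm (_ ^ (2 * m))]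
  exact h.trans (mul_le_mul_of_nonneg_right ((le_abs_self C).trans (by linarith)) (by positivity))

lemma support_deriv_subset_of_isClosed {F : ℝ → ℂ} {K : Set ℝ} (hK : IsClosed K)
    (hF : Function.support F ⊆ K) : Function.support (deriv F) ⊆ K :=
  support_deriv_subset.trans (hK.closure_subset_iff.2 hF)

lemma support_besselStep_iterate_subset (r : ℝ) (c : ℂ) {F : ℝ → ℂ} {K : Set ℝ}
    (hK : IsClosed K) (hF : Function.support F ⊆ K) (m : ℕ) :
    Function.support ((fun G : ℝ → ℂ => fun x : ℝ => G x + c * besselOp r G x)^[m] F) ⊆ K := by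
  induction m with
  | zero => exact hF
  | succ m ih =>
    rw [Function.iterate_succ_apply']
    have h1 := support_deriv_subset_of_isClosed hK ih
    have h2 := support_deriv_subset_of_isClosed hK h1
    rw [Function.support_subset_iff'] at *
    intro x hx
    rw [besselOp, ih x hx, h1 x hx, h2 x hx]
    simp

lemma besselStep_iterate_dilation (r : ℝ) {a : ℝ} (ha : a ≠ 0) {b : ℂ}
    (hb : b * (a : ℂ) ^ 2 = 1) (c : ℂ) (F : ℝ → ℂ) (m : ℕ) :
    (fun G : ℝ → ℂ => fun x : ℝ => G x + b * besselOp r G x)^[m] (fun x => c * F (a * x))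
      = fun x => c * (fun G : ℝ → ℂ => fun x : ℝ => G x + 1 * besselOp r G x)^[m] F (a * x) := by
  have hderiv : ∀ (c : ℂ) (G : ℝ → ℂ),
      deriv (fun x => c * G (a * x)) = fun x => (c * a) * deriv G (a * x) := by
    intro c G
    ext x
    rw [deriv_const_mul_field, deriv_comp_mul_left, Complex.real_smul, mul_assoc]
  induction m with
  | zero => rfl
  | succ m ih =>
    rw [Function.iterate_succ_apply', ih, Function.iterate_succ_apply']
    generalize (fun G : ℝ → ℂ => fun x : ℝ => G x + 1 * besselOp r G x)^[m] F = H
    ext x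
    simp only [besselOp, hderiv]
    have hr : ((r / x : ℝ) : ℂ) = a * ((r / (a * x) : ℝ) : ℂ) := by
      rw [← Complex.ofReal_mul]
      congr 1
      rw [← div_div, div_right_comm, mul_div_cancel₀ _ ha]
    rw [hr]
    linear_combination (-(c * deriv (deriv H) (a * x))
      - c * ((r / (a * x) : ℝ) : ℂ) * deriv H (a * x)) * hb

lemma multPiece_eq_dilation (ψ Φ : ℝ → ℝ) (M : ℕ) (α : ℝ) (ℓ : ℤ) (θ ρ : ℝ) :
    multPiece ψ Φ M α ℓ θ ρ = fun x =>
      Complex.exp ((2 * α * Real.log ((2 : ℝ) ^ ℓ) : ℝ) * Complex.I) *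
        multPiece ψ Φ M α 0 ((2 : ℝ) ^ ℓ * θ * ρ) 1 ((2 : ℝ) ^ (-ℓ) * x) := by
  ext x
  have h2 : (0 : ℝ) < 2 ^ (-ℓ) := by positivity
  have h2' : (0 : ℝ) < 2 ^ ℓ := by positivity
  by_cases hx : 0 < x
  · have hx' : 0 < (2 : ℝ) ^ (-ℓ) * x := mul_pos h2 hx
    have harg : (2 : ℝ) ^ ℓ * θ * ρ * 1 * ((2 : ℝ) ^ (-ℓ) * x) = θ * ρ * x := by
      rw [zpow_neg]
      field_simp
    have hlog : Real.log x = Real.log ((2 : ℝ) ^ ℓ) + Real.log ((2 : ℝ) ^ (-ℓ) * x) := by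
      rw [← Real.log_mul h2'.ne' hx'.ne', ← mul_assoc, ← zpow_add₀ two_ne_zero]
      simp
    simp only [multPiece, if_pos hx, if_pos hx', harg]
    rw [hlog, neg_zero, zpow_zero, one_mul]
    push_cast
    rw [mul_add, Complex.exp_add]
    ring_nf
  · have hx' : ¬ 0 < (2 : ℝ) ^ (-ℓ) * x := fun h => hx (pos_of_mul_pos_right h h2.le)
    simp only [multPiece, if_neg hx, if_neg hx', mul_zero]

lemma besselMeasure_Icc_le {r : ℝ} (hr : 0 ≤ r) {a b : ℝ} (ha : 0 ≤ a) (hab : a ≤ b) :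
    besselMeasure r (Icc a b) ≤ ENNReal.ofReal (b ^ (r + 1)) := by
  have hb : 0 ≤ b := ha.trans hab
  rw [besselMeasure, withDensity_apply _ measurableSet_Icc]
  calc ∫⁻ x in Icc a b, ENNReal.ofReal (x ^ r) ∂(volume.restrict (Ioi 0))
      ≤ ∫⁻ _ in Icc a b, ENNReal.ofReal (b ^ r) ∂(volume.restrict (Ioi 0)) :=
        setLIntegral_mono measurable_const fun x hx =>
          ENNReal.ofReal_le_ofReal (Real.rpow_le_rpow (ha.trans hx.1) hx.2 hr)
    _ = ENNReal.ofReal (b ^ r) * volume.restrict (Ioi 0) (Icc a b) := setLIntegral_const _ _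
    _ ≤ ENNReal.ofReal (b ^ r) * volume (Icc a b) := by
        gcongr
        exact Measure.restrict_le_self
    _ ≤ ENNReal.ofReal (b ^ r) * ENNReal.ofReal b := by
        rw [Real.volume_Icc]
        gcongr
        linarith
    _ = ENNReal.ofReal (b ^ (r + 1)) := by
        rw [← ENNReal.ofReal_mul (by positivity), Real.rpow_add_one' hb (by linarith)]

lemma support_multPiece_subset {ψ : ℝ → ℝ}
    (hψs : Function.support ψ ⊆ {ξ : ℝ | 1 / 4 ≤ |ξ| ∧ |ξ| ≤ 4}) (Φ : ℝ → ℝ) (M : ℕ)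
    (α θ ρ : ℝ) : Function.support (multPiece ψ Φ M α 0 θ ρ) ⊆ Icc (1 / 4) 4 := by
  rw [Function.support_subset_iff']
  intro x hx
  by_cases hx0 : 0 < x
  · have hψ0 : ψ x = 0 := by
      refine Function.support_subset_iff'.1 hψs x fun h => hx ?_
      rwa [mem_ofPred_eq, abs_of_pos hx0] at h
    simp [multPiece, hψ0]
  · simp [multPiece, hx0]

/-- Let `r > 0`, `n = r + 1`, `M ≥ 1`, and let `s₀ = 2m` be a positive even integer.
Let `ψ ∈ C_c^∞(ℝ)` be supported in `{ξ : 1/4 ≤ |ξ| ≤ 4}` and let `Φ` be a Schwartz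
function with `Φ(0) = 1`, `Φ′(0) = 0`. Then there is `C > 0` depending only on
`r, s₀, M, ψ, Φ` such that for all `α ∈ ℝ`, `ℓ ∈ ℤ`, `θ > 0`, `ρ > 0`, with
`F(x) = ψ(2^{−ℓ}x) x^{2iα} (1 − Φ(θρx))^M`,
`‖(1 + 2^{2ℓ}𝓛)^{s₀/2} F‖_{L²(x^r dx)} ≤ C (1+|α|)^{s₀} 2^{ℓn/2} min(1, (2^ℓ θ ρ)^{2M})`,
where `(1 + 2^{2ℓ}𝓛)^{s₀/2}` is the `m`-fold iterate of `F ↦ F + 2^{2ℓ} 𝓛F`. -/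
theorem multiplier_piece_L2_bound (r : ℝ) (hr : 0 < r) (M : ℕ) (hM : 1 ≤ M)
    (m : ℕ) (hm : 0 < m)
    (ψ : ℝ → ℝ) (hψ : ContDiff ℝ (⊤ : ℕ∞) ψ) (hψc : HasCompactSupport ψ)
    (hψs : Function.support ψ ⊆ {ξ : ℝ | 1 / 4 ≤ |ξ| ∧ |ξ| ≤ 4})
    (Φ : SchwartzMap ℝ ℝ) (hΦ0 : Φ 0 = 1) (hΦ1 : deriv (⇑Φ) 0 = 0) :
    ∃ C : ℝ, 0 < C ∧ ∀ (α : ℝ) (ℓ : ℤ) (θ ρ : ℝ), 0 < θ → 0 < ρ →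
      eLpNorm
        ((fun G : ℝ → ℂ => fun x : ℝ => G x + ((2 : ℂ) ^ (2 * ℓ)) * besselOp r G x)^[m]
          (multPiece ψ (⇑Φ) M α ℓ θ ρ)) 2 (besselMeasure r) ≤
      ENNReal.ofReal (C * (1 + |α|) ^ (2 * m) * (2 : ℝ) ^ ((ℓ : ℝ) * (r + 1) / 2) *
        min 1 (((2 : ℝ) ^ ℓ * θ * ρ) ^ (2 * M))) := by
  obtain ⟨C, hC0, hC⟩ := exists_bound_besselStep_iterate_multPiece r M m ψ hψ Φ hΦ0 hΦ1
  refine ⟨C * 4 ^ ((r + 1) / 2), by positivity, fun α ℓ θ ρ hθ hρ => ?_⟩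
  set t : ℝ := (2 : ℝ) ^ ℓ * θ * ρ with ht
  set K : ℝ := C * ((1 + |α|) ^ (2 * m) * min 1 (t ^ (2 * M))) with hKdef
  have hK0 : 0 ≤ K := by positivity
  have h2 : (0 : ℝ) < 2 ^ (-ℓ) := by positivity
  have h2' : (0 : ℝ) < 2 ^ ℓ := by positivity
  have hinv : (2 : ℝ) ^ (-ℓ) * 2 ^ ℓ = 1 := by
    rw [← zpow_add₀ two_ne_zero, neg_add_cancel, zpow_zero]
  have hsupp := support_besselStep_iterate_subset r 1 isClosed_Icc
    (support_multPiece_subset hψs (⇑Φ) M α t 1) m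
  have hb : (2 : ℂ) ^ (2 * ℓ) * (((2 : ℝ) ^ (-ℓ) : ℝ) : ℂ) ^ 2 = 1 := by
    push_cast
    rw [← zpow_natCast, ← zpow_mul, ← zpow_add₀ two_ne_zero]
    simp [mul_comm]
  rw [multPiece_eq_dilation, besselStep_iterate_dilation r h2.ne' hb, ← ht]
  have hpoint : ∀ x : ℝ, ‖Complex.exp ((2 * α * Real.log ((2 : ℝ) ^ ℓ) : ℝ) * Complex.I) *
      (fun G : ℝ → ℂ => fun x : ℝ => G x + 1 * besselOp r G x)^[m]
        (multPiece ψ (⇑Φ) M α 0 t 1) ((2 : ℝ) ^ (-ℓ) * x)‖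
      ≤ ‖(Icc ((2 : ℝ) ^ ℓ * (1 / 4)) (2 ^ ℓ * 4)).indicator (fun _ : ℝ => K) x‖ := by
    intro x
    rw [norm_mul, Complex.norm_exp_ofReal_mul_I, one_mul]
    by_cases hy : (2 : ℝ) ^ (-ℓ) * x ∈ Icc (1 / 4 : ℝ) 4
    · have hx : x = 2 ^ ℓ * ((2 : ℝ) ^ (-ℓ) * x) := by
        rw [← mul_assoc, mul_comm ((2 : ℝ) ^ ℓ), hinv, one_mul]
      have hmem : x ∈ Icc ((2 : ℝ) ^ ℓ * (1 / 4)) (2 ^ ℓ * 4) := by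
        rw [hx]
        exact ⟨mul_le_mul_of_nonneg_left hy.1 h2'.le, mul_le_mul_of_nonneg_left hy.2 h2'.le⟩
      rw [indicator_of_mem hmem, Real.norm_of_nonneg hK0]
      refine (hC α t _ ⟨lt_of_lt_of_le (by norm_num) hy.1,
        lt_of_le_of_lt hy.2 (by norm_num)⟩).trans ?_
      rw [hKdef, pow_mul t]
      gcongr
      exact le_min (pow_le_one₀ (le_min zero_le_one (sq_nonneg t)) (min_le_left _ _))
        (pow_le_pow_left₀ (le_min zero_le_one (sq_nonneg t)) (min_le_right _ _) M)
    · rw [Function.support_subset_iff'.1 hsupp _ hy, norm_zero]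
      exact norm_nonneg _
  have hmeasure := besselMeasure_Icc_le hr.le (a := (2 : ℝ) ^ ℓ * (1 / 4)) (b := 2 ^ ℓ * 4)
    (by positivity) (by gcongr; norm_num)
  have hpow : ((2 : ℝ) ^ ℓ * 4) ^ ((r + 1) * (1 / 2))
      = 2 ^ ((ℓ : ℝ) * (r + 1) / 2) * 4 ^ ((r + 1) / 2) := by
    rw [Real.mul_rpow h2'.le (by norm_num), ← Real.rpow_intCast, ← Real.rpow_mul (by norm_num)]
    ring_nf
  calc _ ≤ eLpNorm ((Icc ((2 : ℝ) ^ ℓ * (1 / 4)) (2 ^ ℓ * 4)).indicator (fun _ : ℝ => K)) 2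
        (besselMeasure r) := eLpNorm_mono hpoint
    _ ≤ ‖K‖ₑ * besselMeasure r (Icc ((2 : ℝ) ^ ℓ * (1 / 4)) (2 ^ ℓ * 4))
        ^ (1 / (2 : ℝ≥0∞).toReal) := eLpNorm_indicator_const_le K 2
    _ ≤ ENNReal.ofReal K * ENNReal.ofReal (((2 : ℝ) ^ ℓ * 4) ^ (r + 1)) ^ (1 / 2 : ℝ) := by
        rw [Real.enorm_of_nonneg hK0, ENNReal.toReal_ofNat]
        gcongr
    _ = ENNReal.ofReal (K * (2 ^ ((ℓ : ℝ) * (r + 1) / 2) * 4 ^ ((r + 1) / 2))) := by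
        rw [ENNReal.ofReal_rpow_of_nonneg (by positivity) (by norm_num),
          ← Real.rpow_mul (by positivity), ← ENNReal.ofReal_mul hK0, hpow]
    _ = _ := by
        congr 1
        rw [hKdef]
        ring
end
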